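/- Let d ≥ 3 and let v : ℝ^d → ℝ be bounded, Borel measurable, with bounded support. Let W_x be standard d-dimensional Brownian motion started at x, and Y_x = ∫₀^∞ v(W_x(s)) ds. Then for each integer k ≥ 0 and each x, E[(∫₀^∞ |v(W_x(s))| ds)^k] ≤ k! · K₁^k, where K₁ = sup_y ∫₀^∞ ∫ |v(z)| q(s; z-y) dz ds (which is finite). -/

import Mathlib

open MeasureTheory Real Filter Topology ProbabilityTheory

noncomputable section

/-- Euclidean space `ℝ^d`. -/
abbrev Euc (d : ℕ) := EuclideanSpace ℝ (Fin d)

/-- The Brownian transition density `q(s; w) = (2πs)^{-d/2} exp(-|w|²/(2s))`. -/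
def heatKernel (d : ℕ) (s : ℝ) (w : Euc d) : ℝ :=
  (2 * π * s) ^ (-(d : ℝ) / 2) * Real.exp (-‖w‖ ^ 2 / (2 * s))

/-- Joint density of a Brownian motion started at `x`, at times `s 0 < s 1 < ⋯`. -/
def jointDensity (d : ℕ) {k : ℕ} (x : Euc d) (s : Fin k → ℝ) (z : Fin k → Euc d) : ℝ :=
  ∏ j : Fin k,
    heatKernel d (s j - if (j : ℕ) = 0 then 0 else s ⟨(j : ℕ) - 1, lt_of_le_of_lt (Nat.sub_le _ _) j.isLt⟩)
      (z j - if (j : ℕ) = 0 then x else z ⟨(j : ℕ) - 1, lt_of_le_of_lt (Nat.sub_le _ _) j.isLt⟩)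

/-- Joint density of the Brownian bridge from `a` to `b` in time `t`, at interior times `s`. -/
def bridgeDensity (d : ℕ) {k : ℕ} (t : ℝ) (a b : Euc d) (s : Fin k → ℝ) (z : Fin k → Euc d) : ℝ :=
  jointDensity d a (Fin.snoc s t) (Fin.snoc z b) / heatKernel d t (b - a)

/-- The open ordered simplex `0 < s₁ < ⋯ < s_k < t`. -/
def simplex (k : ℕ) (t : ℝ) : Set (Fin k → ℝ) :=
  {s | StrictMono s ∧ ∀ i, 0 < s i ∧ s i < t}

/-- `W` is a standard `d`-dimensional Brownian motion started at `x`, characterized by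
continuous paths and finite-dimensional densities given by products of heat kernels. -/
def IsBrownianMotion {Ω : Type*} [MeasureSpace Ω] {d : ℕ} (x : Euc d)
    (W : ℝ → Ω → Euc d) : Prop :=
  (∀ ω, W 0 ω = x) ∧ (∀ ω, Continuous fun s => W s ω) ∧
  ∀ (k : ℕ) (s : Fin (k + 1) → ℝ), StrictMono s → (∀ i, 0 < s i) →
    Measure.map (fun ω (i : Fin (k + 1)) => W (s i) ω) (ℙ : Measure Ω) =
      (volume : Measure (Fin (k + 1) → Euc d)).withDensity
        (fun z => ENNReal.ofReal (jointDensity d x s z))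

/-- `X` is a `d`-dimensional Brownian bridge from `a` to `b` in time `t`. -/
def IsBrownianBridge {Ω : Type*} [MeasureSpace Ω] {d : ℕ} (t : ℝ) (a b : Euc d)
    (X : ℝ → Ω → Euc d) : Prop :=
  (∀ ω, X 0 ω = a) ∧ (∀ ω, X t ω = b) ∧
  (∀ ω, ContinuousOn (fun s => X s ω) (Set.Icc 0 t)) ∧
  ∀ (k : ℕ) (s : Fin (k + 1) → ℝ), StrictMono s → (∀ i, 0 < s i ∧ s i < t) →
    Measure.map (fun ω (i : Fin (k + 1)) => X (s i) ω) (ℙ : Measure Ω) =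
      (volume : Measure (Fin (k + 1) → Euc d)).withDensity
        (fun z => ENNReal.ofReal (bridgeDensity d t a b s z))

/-- The path integral `∫₀^t v(X_s) ds`. -/
def pathInt {Ω : Type*} {d : ℕ} (v : Euc d → ℝ) (X : ℝ → Ω → Euc d) (t : ℝ) (ω : Ω) : ℝ :=
  ∫ s in Set.Ioc (0 : ℝ) t, v (X s ω)

/-- The total path integral `∫₀^∞ v(X_s) ds`. -/
def pathIntInf {Ω : Type*} {d : ℕ} (v : Euc d → ℝ) (X : ℝ → Ω → Euc d) (ω : Ω) : ℝ :=
  ∫ s in Set.Ioi (0 : ℝ), v (X s ω)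

/-- The density ratio `Q_{j} = q(t; y - x)/q(Δ_j s; Δ_j z)` with the conventions
`s₀ = 0`, `s_{k+1} = t`, `z₀ = x`, `z_{k+1} = y`. -/
def Qratio (d : ℕ) {k : ℕ} (t : ℝ) (x y : Euc d) (s : Fin k → ℝ) (z : Fin k → Euc d)
    (j : Fin (k + 1)) : ℝ :=
  heatKernel d t (y - x) /
    heatKernel d
      ((Fin.cons 0 (Fin.snoc s t) : Fin (k + 2) → ℝ) j.succ -
        (Fin.cons 0 (Fin.snoc s t) : Fin (k + 2) → ℝ) j.castSucc)
      ((Fin.cons x (Fin.snoc z y) : Fin (k + 2) → Euc d) j.succ -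
        (Fin.cons x (Fin.snoc z y) : Fin (k + 2) → Euc d) j.castSucc)

open scoped ENNReal

theorem lintegral_fin_succ_pi {α : Type*} [MeasureSpace α] [SigmaFinite (volume : Measure α)]
    (n : ℕ) {F : (Fin (n + 1) → α) → ℝ≥0∞} (hF : Measurable F) :
    ∫⁻ s, F s = ∫⁻ s : Fin n → α, ∫⁻ r : α, F (Fin.snoc s r) := by
  have hmp := (volume_preserving_piFinSuccAbove (fun _ : Fin (n + 1) => α) (Fin.last n)).symm
  rw [← hmp.lintegral_comp hF]
  have hm : Measurable fun p => F ((MeasurableEquiv.piFinSuccAbove (fun _ : Fin (n + 1) => α)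
      (Fin.last n)).symm p) := hF.comp (MeasurableEquiv.measurable _)
  refine (lintegral_prod_symm' _ hm).trans ?_
  simp only [MeasurableEquiv.piFinSuccAbove_symm_apply, Fin.insertNthEquiv,
    Equiv.coe_fn_mk, Fin.insertNth_last']

theorem lintegral_pow_eq_lintegral_pi {α : Type*} [MeasureSpace α]
    [SigmaFinite (volume : Measure α)] {g : α → ℝ≥0∞} (hg : Measurable g) (k : ℕ) :
    (∫⁻ t, g t) ^ k = ∫⁻ s : Fin k → α, ∏ i, g (s i) := by
  induction k with
  | zero => simp [volume_pi]
  | succ n ih =>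
    rw [lintegral_fin_succ_pi n (by fun_prop)]
    simp only [Fin.prod_univ_castSucc, Fin.snoc_castSucc, Fin.snoc_last]
    simp_rw [lintegral_const_mul _ hg]
    rw [lintegral_mul_const _ (by fun_prop), pow_succ, ih]

theorem measurableSet_strictMono (k : ℕ) : MeasurableSet {s : Fin k → ℝ | StrictMono s} := by
  simp only [StrictMono, Set.ofPred_forall]
  refine MeasurableSet.iInter fun i => MeasurableSet.iInter fun j => MeasurableSet.iInter fun _ => ?_
  exact measurableSet_lt (measurable_pi_apply i) (measurable_pi_apply j)

theorem ae_injective_pi_real (k : ℕ) : ∀ᵐ s : Fin k → ℝ, Function.Injective s := by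
  have h : ∀ i j : Fin k, ∀ᵐ s : Fin k → ℝ, s i = s j → i = j := by
    intro i j
    by_cases hij : i = j
    · exact ae_of_all _ fun _ _ => hij
    · let p : Submodule ℝ (Fin k → ℝ) :=
        LinearMap.ker ((LinearMap.proj i : (Fin k → ℝ) →ₗ[ℝ] ℝ) - LinearMap.proj j)
      have hp : p ≠ ⊤ := by
        intro htop
        have hmem : (Pi.single i 1 : Fin k → ℝ) ∈ p := htop ▸ Submodule.mem_top
        simp [p, Ne.symm hij] at hmem
      have h0 := Measure.addHaar_submodule (volume : Measure (Fin k → ℝ)) p hp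
      rw [ae_iff]
      refine measure_mono_null (fun s hs => ?_) h0
      simp only [Set.mem_ofPred_eq, Classical.not_imp] at hs
      simp [p, hs.1]
  filter_upwards [ae_all_iff.2 fun i => ae_all_iff.2 fun j => h i j] with s hs i j hij
  exact hs i j hij

/-- The `k`-th power of an integral is at most `k!` times the integral over the ordered simplex. -/
theorem lintegral_pow_le_factorial_mul {g : ℝ → ℝ≥0∞} (hg : Measurable g) (k : ℕ) :
    (∫⁻ t, g t) ^ k ≤ (k.factorial : ℝ≥0∞) *
      ∫⁻ s : Fin k → ℝ, {s | StrictMono s}.indicator (fun s => ∏ i, g (s i)) s := by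
  set G : (Fin k → ℝ) → ℝ≥0∞ := {s | StrictMono s}.indicator (fun s => ∏ i, g (s i)) with hG
  have hGm : Measurable G := Measurable.indicator (by fun_prop) (measurableSet_strictMono k)
  have hperm : ∀ σ : Equiv.Perm (Fin k), ∫⁻ s, G (s ∘ σ) = ∫⁻ s, G s := by
    intro σ
    have hmp := volume_measurePreserving_piCongrLeft (fun _ : Fin k => ℝ) σ.symm
    rw [← hmp.lintegral_comp hGm]
    refine lintegral_congr fun s => ?_
    congr 1
    ext i
    simpa using (MeasurableEquiv.piCongrLeft_apply_apply (β := fun _ : Fin k => ℝ) σ.symm s (σ i)).symm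
  rw [lintegral_pow_eq_lintegral_pi hg]
  calc ∫⁻ s : Fin k → ℝ, ∏ i, g (s i)
      ≤ ∫⁻ s : Fin k → ℝ, ∑ σ : Equiv.Perm (Fin k), G (s ∘ σ) := by
        refine lintegral_mono_ae ?_
        filter_upwards [ae_injective_pi_real k] with s hs
        have hmono : StrictMono (s ∘ Tuple.sort s) :=
          (Tuple.monotone_sort s).strictMono_of_injective (hs.comp (Tuple.sort s).injective)
        have heq : ∏ i, g (s i) = G (s ∘ Tuple.sort s) := by
          rw [hG, Set.indicator_of_mem (show s ∘ Tuple.sort s ∈ {s | StrictMono s} from hmono)]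
          exact (Equiv.prod_comp (Tuple.sort s) fun i => g (s i)).symm
        rw [heq]
        exact Finset.single_le_sum (f := fun σ : Equiv.Perm (Fin k) => G (s ∘ σ))
          (fun _ _ => zero_le) (Finset.mem_univ _)
    _ = ∑ σ : Equiv.Perm (Fin k), ∫⁻ s : Fin k → ℝ, G (s ∘ σ) := by
        refine lintegral_finsetSum _ fun σ _ => hGm.comp ?_
        exact measurable_pi_lambda _ fun i => measurable_pi_apply _
    _ = (k.factorial : ℝ≥0∞) * ∫⁻ s, G s := by
        simp [hperm, Fintype.card_perm]

/-- The entry before position `j` of a tuple, with `a` in front of the first entry. -/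
def prevEntry {α : Type*} {k : ℕ} (a : α) (s : Fin k → α) (j : Fin k) : α :=
  if (j : ℕ) = 0 then a else s ⟨(j : ℕ) - 1, lt_of_le_of_lt (Nat.sub_le _ _) j.isLt⟩

theorem measurable_prevEntry {α : Type*} [MeasurableSpace α] {k : ℕ} (a : α) (j : Fin k) :
    Measurable fun s : Fin k → α => prevEntry a s j := by
  unfold prevEntry
  split_ifs
  · exact measurable_const
  · exact measurable_pi_apply _

theorem prevEntry_snoc_castSucc {α : Type*} {k : ℕ} (a : α) (s : Fin k → α) (t : α) (j : Fin k) :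
    prevEntry a (Fin.snoc s t : Fin (k + 1) → α) j.castSucc = prevEntry a s j := by
  unfold prevEntry
  simp only [Fin.val_castSucc]
  split_ifs
  · rfl
  · exact Fin.snoc_castSucc (α := fun _ => α) t s ⟨(j : ℕ) - 1, _⟩

theorem exists_prevEntry_snoc_last {α : Type*} [MeasurableSpace α] {k : ℕ} (a : α) :
    ∃ l : (Fin k → α) → α, Measurable l ∧
      ∀ s t, prevEntry a (Fin.snoc s t : Fin (k + 1) → α) (Fin.last k) = l s := by
  rcases k with _ | k
  · exact ⟨fun _ => a, measurable_const, fun s t => by simp [prevEntry]⟩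
  · refine ⟨fun s => s (Fin.last k), measurable_pi_apply _, fun s t => ?_⟩
    simp only [prevEntry, Fin.val_last, Nat.add_eq_zero_iff, one_ne_zero, and_false, if_false]
    exact Fin.snoc_castSucc (α := fun _ => α) t s (Fin.last k)

/-- Iterating a one-step bound along a chain of transition kernels. -/
theorem lintegral_chain_le {α β : Type*} [MeasureSpace α] [MeasureSpace β]
    [SigmaFinite (volume : Measure α)] [SigmaFinite (volume : Measure β)]
    {h : (α × β) × (α × β) → ℝ≥0∞} (hh : Measurable h) {K : ℝ≥0∞}
    (hK : ∀ p, ∫⁻ t, ∫⁻ z, h (p, (t, z)) ≤ K) (a : α) (b : β) (k : ℕ) :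
    ∫⁻ s : Fin k → α, ∫⁻ z : Fin k → β,
      ∏ j, h ((prevEntry a s j, prevEntry b z j), (s j, z j)) ≤ K ^ k := by
  have hmeas : ∀ k : ℕ, Measurable fun p : (Fin k → α) × (Fin k → β) =>
      ∏ j, h ((prevEntry a p.1 j, prevEntry b p.2 j), (p.1 j, p.2 j)) := by
    intro k
    refine Finset.measurable_prod _ fun j _ => hh.comp ?_
    have h1 := (measurable_prevEntry a j).comp
      (measurable_fst : Measurable (Prod.fst : (Fin k → α) × (Fin k → β) → _))
    have h2 := (measurable_prevEntry b j).comp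
      (measurable_snd : Measurable (Prod.snd : (Fin k → α) × (Fin k → β) → _))
    exact (h1.prodMk h2).prodMk (by fun_prop)
  induction k with
  | zero => simp [volume_pi]
  | succ n ih =>
    obtain ⟨l, hl, hl'⟩ := exists_prevEntry_snoc_last (k := n) a
    obtain ⟨m, hm, hm'⟩ := exists_prevEntry_snoc_last (k := n) b
    rw [lintegral_fin_succ_pi n (hmeas (n + 1)).lintegral_prod_right']
    have hinner : ∀ (s : Fin (n + 1) → α), Measurable fun z : Fin (n + 1) → β =>
        ∏ j, h ((prevEntry a s j, prevEntry b z j), (s j, z j)) :=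
      fun s => (hmeas (n + 1)).comp measurable_prodMk_left
    simp_rw [fun s => lintegral_fin_succ_pi n (hinner s), Fin.prod_univ_castSucc,
      prevEntry_snoc_castSucc, Fin.snoc_castSucc, Fin.snoc_last, hl', hm']
    rw [pow_succ]
    refine le_trans ?_ (mul_le_mul_left ih K)
    rw [← lintegral_mul_const _ (hmeas n).lintegral_prod_right']
    refine lintegral_mono fun s => ?_
    have hstep : ∀ (z : Fin n → β) (t : α), Measurable fun y => h ((l s, m z), (t, y)) :=
      fun z t => by fun_prop
    have hstep' : ∀ (z : Fin n → β), Measurable fun t => ∫⁻ y, h ((l s, m z), (t, y)) :=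
      fun z => Measurable.lintegral_prod_right' (f := fun p : α × β => h ((l s, m z), p))
        (by fun_prop)
    have hs : Measurable fun z : Fin n → β =>
        ∏ j, h ((prevEntry a s j, prevEntry b z j), (s j, z j)) :=
      (hmeas n).comp measurable_prodMk_left
    rw [lintegral_congr fun t => lintegral_congr fun z => lintegral_const_mul _ (hstep z t)]
    change _ ≤ (∫⁻ z : Fin n → β, ∏ j, h ((prevEntry a s j, prevEntry b z j), (s j, z j))) * K
    rw [lintegral_lintegral_swap, ← lintegral_mul_const _ hs]
    · refine lintegral_mono fun z => ?_
      dsimp only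
      rw [lintegral_const_mul _ (hstep' z)]
      gcongr
      exact hK _
    · refine Measurable.aemeasurable ?_
      refine Measurable.mul (hs.comp measurable_snd) ?_
      exact Measurable.lintegral_prod_right'
        (f := fun q : (α × (Fin n → β)) × β => h ((l s, m q.1.2), (q.1.1, q.2))) (by fun_prop)

theorem heatKernel_pos (d : ℕ) {s : ℝ} (hs : 0 < s) (w : Euc d) : 0 < heatKernel d s w := by
  unfold heatKernel
  positivity

theorem lintegral_heatKernel (d : ℕ) {s : ℝ} (hs : 0 < s) (y : Euc d) :
    ∫⁻ z : Euc d, ENNReal.ofReal (heatKernel d s (z - y)) = 1 := by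
  have hpos : 0 < (2 * π * s) ^ ((d : ℝ) / 2) := by positivity
  have hint : ∫ w : Euc d, Real.exp (-(1 / (2 * s)) * ‖w‖ ^ 2) = (2 * π * s) ^ ((d : ℝ) / 2) := by
    rw [GaussianFourier.integral_rexp_neg_mul_sq_norm (by positivity)]
    simp only [finrank_euclideanSpace, Fintype.card_fin]
    congr 1
    field_simp
  have hI : Integrable fun w : Euc d => Real.exp (-(1 / (2 * s)) * ‖w‖ ^ 2) := by
    by_contra h
    rw [integral_undef h] at hint
    exact hpos.ne hint
  have hker : heatKernel d s = fun w : Euc d =>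
      (2 * π * s) ^ (-(d : ℝ) / 2) * Real.exp (-(1 / (2 * s)) * ‖w‖ ^ 2) := by
    ext w
    unfold heatKernel
    congr 2
    ring
  rw [lintegral_sub_right_eq_self (fun w : Euc d => ENNReal.ofReal (heatKernel d s w)) y,
    ← ofReal_integral_eq_lintegral_ofReal (hker ▸ hI.const_mul _)
      (ae_of_all _ fun w => (heatKernel_pos d hs w).le), hker, integral_const_mul, hint,
    ← Real.rpow_add (by positivity)]
  simp [neg_div]

theorem heatKernel_le_rpow {d : ℕ} (hd : 3 ≤ d) {s : ℝ} (hs : 1 < s) (w : Euc d) :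
    heatKernel d s w ≤ s ^ (-(3 / 2) : ℝ) := by
  have hs0 : 0 < s := by linarith
  have hd' : (3 : ℝ) ≤ d := by exact_mod_cast hd
  have h1 : Real.exp (-‖w‖ ^ 2 / (2 * s)) ≤ 1 := by
    rw [Real.exp_le_one_iff, neg_div]
    exact neg_nonpos.2 (by positivity)
  have hle : s ≤ 2 * π * s := by nlinarith [Real.pi_gt_three]
  calc heatKernel d s w ≤ (2 * π * s) ^ (-(d : ℝ) / 2) :=
        mul_le_of_le_one_right (by positivity) h1
    _ ≤ s ^ (-(d : ℝ) / 2) := Real.rpow_le_rpow_of_nonpos hs0 hle (by linarith)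
    _ ≤ s ^ (-(3 / 2) : ℝ) := Real.rpow_le_rpow_of_exponent_le hs.le (by linarith)

/-- In dimension at least three the Green potential of a bounded compactly supported function is
bounded. -/
theorem iSup_potential_ne_top {d : ℕ} (hd : 3 ≤ d) {v : Euc d → ℝ}
    (hvb : ∃ C : ℝ, ∀ z, |v z| ≤ C) (hvs : ∃ R : ℝ, ∀ z, v z ≠ 0 → ‖z‖ ≤ R) :
    (⨆ y : Euc d, ∫⁻ s in Set.Ioi (0 : ℝ), ∫⁻ z : Euc d,
      ENNReal.ofReal (|v z| * heatKernel d s (z - y))) ≠ ∞ := by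
  obtain ⟨C, hC⟩ := hvb
  obtain ⟨R, hR⟩ := hvs
  have hC0 : 0 ≤ C := (abs_nonneg _).trans (hC 0)
  set V : ℝ≥0∞ := volume (Metric.closedBall (0 : Euc d) R)
  have hV : V ≠ ∞ := measure_closedBall_lt_top.ne
  set J : ℝ≥0∞ := ∫⁻ s in Set.Ioi (1 : ℝ), ENNReal.ofReal (s ^ (-(3 / 2) : ℝ))
  have hJ : J ≠ ∞ := by
    have hint := integrableOn_Ioi_rpow_of_lt (a := -(3 / 2)) (c := 1) (by norm_num) one_pos
    exact hint.lintegral_lt_top.ne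
  have hsmall : ∀ (y : Euc d) (s : ℝ), s ∈ Set.Ioc (0 : ℝ) 1 →
      ∫⁻ z : Euc d, ENNReal.ofReal (|v z| * heatKernel d s (z - y)) ≤ ENNReal.ofReal C := by
    intro y s hs
    calc ∫⁻ z : Euc d, ENNReal.ofReal (|v z| * heatKernel d s (z - y))
        ≤ ∫⁻ z : Euc d, ENNReal.ofReal C * ENNReal.ofReal (heatKernel d s (z - y)) := by
          refine lintegral_mono fun z => ?_
          rw [← ENNReal.ofReal_mul hC0]
          exact ENNReal.ofReal_le_ofReal
            (mul_le_mul_of_nonneg_right (hC z) (heatKernel_pos d hs.1 _).le)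
      _ = ENNReal.ofReal C := by
          rw [lintegral_const_mul' _ _ ENNReal.ofReal_ne_top, lintegral_heatKernel d hs.1, mul_one]
  have hlarge : ∀ (y : Euc d) (s : ℝ), s ∈ Set.Ioi (1 : ℝ) →
      ∫⁻ z : Euc d, ENNReal.ofReal (|v z| * heatKernel d s (z - y)) ≤
        ENNReal.ofReal (s ^ (-(3 / 2) : ℝ)) * (ENNReal.ofReal C * V) := by
    intro y s hs
    calc ∫⁻ z : Euc d, ENNReal.ofReal (|v z| * heatKernel d s (z - y))
        ≤ ∫⁻ z : Euc d, (Metric.closedBall (0 : Euc d) R).indicator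
            (fun _ => ENNReal.ofReal (s ^ (-(3 / 2) : ℝ)) * ENNReal.ofReal C) z := by
          refine lintegral_mono fun z => ?_
          by_cases hz : v z = 0
          · simp [hz]
          · rw [Set.indicator_of_mem (mem_closedBall_zero_iff.2 (hR z hz)), mul_comm,
              ← ENNReal.ofReal_mul (Real.rpow_nonneg (zero_le_one.trans (le_of_lt hs)) _)]
            exact ENNReal.ofReal_le_ofReal (mul_le_mul (heatKernel_le_rpow hd hs _) (hC z)
              (abs_nonneg _) (Real.rpow_nonneg (zero_le_one.trans (le_of_lt hs)) _))
      _ = ENNReal.ofReal (s ^ (-(3 / 2) : ℝ)) * (ENNReal.ofReal C * V) := by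
          rw [lintegral_indicator_const measurableSet_closedBall, mul_assoc]
  have hCV : ENNReal.ofReal C * V ≠ ∞ := ENNReal.mul_ne_top ENNReal.ofReal_ne_top hV
  refine ne_top_of_le_ne_top (b := ENNReal.ofReal C + J * (ENNReal.ofReal C * V)) ?_
    (iSup_le fun y => ?_)
  · exact ENNReal.add_ne_top.2 ⟨ENNReal.ofReal_ne_top, ENNReal.mul_ne_top hJ hCV⟩
  · rw [← Set.Ioc_union_Ioi_eq_Ioi (zero_le_one : (0 : ℝ) ≤ 1)]
    refine (lintegral_union_le _ _ _).trans (add_le_add ?_ ?_)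
    · refine (setLIntegral_mono' measurableSet_Ioc (hsmall y)).trans ?_
      simp
    · refine (setLIntegral_mono' measurableSet_Ioi (hlarge y)).trans ?_
      rw [lintegral_mul_const' _ _ hCV]

/-- The one-step transition kernel of Brownian motion weighted by `|v|` at the arrival point,
restricted to increasing times. -/
def weightedStep (d : ℕ) (v : Euc d → ℝ) : (ℝ × Euc d) × (ℝ × Euc d) → ℝ≥0∞ :=
  {q | q.1.1 < q.2.1}.indicator fun q =>
    ENNReal.ofReal (|v q.2.2| * heatKernel d (q.2.1 - q.1.1) (q.2.2 - q.1.2))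

theorem measurable_weightedStep (d : ℕ) {v : Euc d → ℝ} (hv : Measurable v) :
    Measurable (weightedStep d v) := by
  refine Measurable.indicator ?_ (measurableSet_lt (by fun_prop) (by fun_prop))
  unfold heatKernel
  fun_prop

theorem lintegral_weightedStep (d : ℕ) (v : Euc d → ℝ) (p : ℝ × Euc d) :
    ∫⁻ t, ∫⁻ z, weightedStep d v (p, (t, z)) =
      ∫⁻ s in Set.Ioi (0 : ℝ), ∫⁻ z : Euc d,
        ENNReal.ofReal (|v z| * heatKernel d s (z - p.2)) := by
  rw [← lintegral_indicator measurableSet_Ioi, ← lintegral_sub_right_eq_self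
    ((Set.Ioi (0 : ℝ)).indicator fun s => ∫⁻ z : Euc d,
      ENNReal.ofReal (|v z| * heatKernel d s (z - p.2))) p.1]
  refine lintegral_congr fun t => ?_
  by_cases h : p.1 < t
  · rw [Set.indicator_of_mem (by simpa using h)]
    refine lintegral_congr fun z => ?_
    exact Set.indicator_of_mem (s := {q : (ℝ × Euc d) × (ℝ × Euc d) | q.1.1 < q.2.1}) h _
  · rw [Set.indicator_of_notMem (by simpa using h)]
    refine (lintegral_congr fun z => ?_).trans lintegral_zero
    exact Set.indicator_of_notMem (s := {q : (ℝ × Euc d) × (ℝ × Euc d) | q.1.1 < q.2.1}) h _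

theorem prevEntry_lt {k : ℕ} {s : Fin k → ℝ} (hs : StrictMono s)
    (hs0 : ∀ i, 0 < s i) (j : Fin k) : prevEntry 0 s j < s j := by
  unfold prevEntry
  split_ifs with hj
  · exact hs0 j
  · exact hs (Fin.lt_def.2 (Nat.sub_lt (Nat.pos_of_ne_zero hj) one_pos))

theorem jointDensity_eq_prod {d k : ℕ} (x : Euc d) (s : Fin k → ℝ) (z : Fin k → Euc d) :
    jointDensity d x s z =
      ∏ j, heatKernel d (s j - prevEntry 0 s j) (z j - prevEntry x z j) := rfl

theorem jointDensity_pos {d k : ℕ} (x : Euc d) {s : Fin k → ℝ} (hs : StrictMono s)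
    (hs0 : ∀ i, 0 < s i) (z : Fin k → Euc d) : 0 < jointDensity d x s z := by
  rw [jointDensity_eq_prod]
  exact Finset.prod_pos fun j _ => heatKernel_pos d (sub_pos.2 (prevEntry_lt hs hs0 j)) _

theorem measurable_jointDensity {d k : ℕ} (x : Euc d) (s : Fin k → ℝ) :
    Measurable (jointDensity d x s) := by
  have hm := fun j => measurable_prevEntry (k := k) x j
  unfold jointDensity heatKernel
  change Measurable fun z : Fin k → Euc d => ∏ j, (2 * π * (s j - prevEntry 0 s j)) ^ (-(d : ℝ) / 2) *
    Real.exp (-‖z j - prevEntry x z j‖ ^ 2 / (2 * (s j - prevEntry 0 s j)))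
  fun_prop

theorem prod_ofReal_mul_jointDensity {d k : ℕ} (v : Euc d → ℝ) (x : Euc d) {s : Fin k → ℝ}
    (hs : StrictMono s) (hs0 : ∀ i, 0 < s i) (z : Fin k → Euc d) :
    ENNReal.ofReal (jointDensity d x s z) * ∏ j, ENNReal.ofReal |v (z j)| =
      ∏ j, weightedStep d v ((prevEntry 0 s j, prevEntry x z j), (s j, z j)) := by
  rw [jointDensity_eq_prod, ENNReal.ofReal_prod_of_nonneg, ← Finset.prod_mul_distrib]
  · refine Finset.prod_congr rfl fun j _ => ?_
    have hlt := prevEntry_lt hs hs0 j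
    rw [weightedStep, Set.indicator_of_mem (by exact hlt), ENNReal.ofReal_mul (abs_nonneg _),
      mul_comm]
  · exact fun j _ => (heatKernel_pos d (sub_pos.2 (prevEntry_lt hs hs0 j)) _).le

namespace IsBrownianMotion

variable {Ω : Type*} [MeasureSpace Ω] {d : ℕ} {x : Euc d} {W : ℝ → Ω → Euc d}

theorem aemeasurable (hW : IsBrownianMotion x W) {t : ℝ} (ht : 0 < t) :
    AEMeasurable (W t) (ℙ : Measure Ω) := by
  have hmono : StrictMono fun _ : Fin (0 + 1) => t :=
    fun i j hij => absurd hij (by omega)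
  have hpos : ∀ _ : Fin (0 + 1), 0 < t := fun _ => ht
  have hmap := hW.2.2 0 (fun _ => t) hmono hpos
  by_contra hn
  have hn' : ¬ AEMeasurable (fun ω (_ : Fin (0 + 1)) => W t ω) (ℙ : Measure Ω) :=
    fun h => hn (aemeasurable_pi_iff.1 h 0)
  rw [Measure.map_of_not_aemeasurable hn'] at hmap
  have hm := (measurable_jointDensity x fun _ : Fin (0 + 1) => t).ennreal_ofReal
  have hz := (withDensity_eq_zero_iff hm.aemeasurable).1 hmap.symm
  have hfalse : ∀ᵐ _ : Fin (0 + 1) → Euc d, False := by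
    filter_upwards [hz] with z hz
    have := jointDensity_pos x hmono hpos z
    exact (ENNReal.ofReal_pos.2 this).ne' hz
  exact NeZero.ne (volume : Measure (Fin (0 + 1) → Euc d))
    (ae_eq_bot.1 (Filter.eventually_false_iff_eq_bot.1 hfalse))

/-- A Brownian motion agrees almost surely with a jointly measurable process. -/
theorem exists_measurable_modification (hW : IsBrownianMotion x W) :
    ∃ U : ℝ → Ω → Euc d, Measurable (Function.uncurry U) ∧
      ∀ᵐ ω ∂(ℙ : Measure Ω), ∀ s, 0 < s → U s ω = W s ω := by
  classical
  have hae : ∀ᵐ ω ∂(ℙ : Measure Ω), ∀ q : ℚ, ∀ hq : 0 < (q : ℝ),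
      W q ω = (hW.aemeasurable hq).mk _ ω :=
    ae_all_iff.2 fun q => ae_all_iff.2 fun hq => (hW.aemeasurable hq).ae_eq_mk
  obtain ⟨N, hsub, hN, hN0⟩ := exists_measurable_superset_of_null (ae_iff.1 hae)
  have hgood : ∀ ω, ω ∉ N → ∀ q : ℚ, ∀ hq : 0 < (q : ℝ), W q ω = (hW.aemeasurable hq).mk _ ω := by
    intro ω hω
    by_contra h
    exact hω (hsub h)
  refine ⟨fun s ω => if ω ∈ N then x else W (max s 0) ω, ?_, ?_⟩
  · refine measurable_uncurry_of_continuous_of_measurable (fun ω => ?_) fun s => ?_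
    · by_cases hω : ω ∈ N
      · simp only [hω, if_true]
        exact continuous_const
      · simp only [hω, if_false]
        exact (hW.2.1 ω).comp (by fun_prop)
    · rcases le_or_gt s 0 with hs | hs
      · simp only [max_eq_right hs, hW.1, ite_self]
        exact measurable_const
      · simp only [max_eq_left hs.le]
        have hq : ∀ n : ℕ, ∃ q : ℚ, s < q ∧ (q : ℝ) < s + 1 / ((n : ℝ) + 1) := fun n =>
          exists_rat_btwn (by linarith [Nat.one_div_pos_of_nat (α := ℝ) (n := n)])
        choose q hq1 hq2 using hq
        have hlim : Tendsto (fun n => (q n : ℝ)) atTop (𝓝 s) := by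
          refine tendsto_of_tendsto_of_tendsto_of_le_of_le tendsto_const_nhds ?_
            (fun n => (hq1 n).le) fun n => (hq2 n).le
          simpa using (tendsto_const_nhds (x := s)).add tendsto_one_div_add_atTop_nhds_zero_nat
        refine measurable_of_tendsto_metrizable
          (f := fun n ω => if ω ∈ N then x else W (q n) ω) (fun n => ?_) ?_
        · have hqn := hs.trans (hq1 n)
          have heq : (fun ω => if ω ∈ N then x else W (q n) ω) =
              fun ω => if ω ∈ N then x else (hW.aemeasurable hqn).mk _ ω := by
            ext1 ω
            by_cases hω : ω ∈ N
            · simp only [hω, if_true]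
            · simp only [hω, if_false, hgood ω hω (q n) hqn]
          rw [heq]
          exact Measurable.ite hN measurable_const (hW.aemeasurable hqn).measurable_mk
        · refine tendsto_pi_nhds.2 fun ω => ?_
          by_cases hω : ω ∈ N
          · simp only [hω, if_true]
            exact tendsto_const_nhds
          · simp only [hω, if_false]
            exact ((hW.2.1 ω).tendsto s).comp hlim
  · filter_upwards [measure_eq_zero_iff_ae_notMem.1 hN0] with ω hω s hs
    simp [hω, max_eq_left hs.le]

theorem lintegral_prod_eq (hW : IsBrownianMotion x W) [IsProbabilityMeasure (ℙ : Measure Ω)]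
    {v : Euc d → ℝ} (hv : Measurable v) {k : ℕ} {s : Fin k → ℝ} (hs : StrictMono s)
    (hs0 : ∀ i, 0 < s i) :
    ∫⁻ ω, ∏ i, ENNReal.ofReal |v (W (s i) ω)| =
      ∫⁻ z : Fin k → Euc d,
        ∏ j, weightedStep d v ((prevEntry 0 s j, prevEntry x z j), (s j, z j)) := by
  rcases k with _ | k
  · simp [volume_pi]
  · have hm : AEMeasurable (fun ω (i : Fin (k + 1)) => W (s i) ω) (ℙ : Measure Ω) :=
      aemeasurable_pi_iff.2 fun i => hW.aemeasurable (hs0 i)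
    have hg : Measurable fun z : Fin (k + 1) → Euc d => ∏ i, ENNReal.ofReal |v (z i)| := by
      fun_prop
    rw [← lintegral_map' hg.aemeasurable hm, hW.2.2 k s hs hs0,
      lintegral_withDensity_eq_lintegral_mul _ (measurable_jointDensity x s).ennreal_ofReal hg]
    exact lintegral_congr fun z => prod_ofReal_mul_jointDensity v x hs hs0 z

/-- Moment bound for the total occupation integral in terms of a bound on the potential. -/
theorem lintegral_pow_le (hW : IsBrownianMotion x W) [IsProbabilityMeasure (ℙ : Measure Ω)]
    {v : Euc d → ℝ} (hv : Measurable v) {K : ℝ≥0∞}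
    (hK : ∀ y : Euc d, ∫⁻ s in Set.Ioi (0 : ℝ), ∫⁻ z : Euc d,
      ENNReal.ofReal (|v z| * heatKernel d s (z - y)) ≤ K) (k : ℕ) :
    ∫⁻ ω, (∫⁻ s in Set.Ioi (0 : ℝ), ENNReal.ofReal |v (W s ω)|) ^ k ≤
      (k.factorial : ℝ≥0∞) * K ^ k := by
  obtain ⟨U, hU, hUW⟩ := hW.exists_measurable_modification
  set g : Ω → ℝ → ℝ≥0∞ := fun ω =>
    (Set.Ioi (0 : ℝ)).indicator fun s => ENNReal.ofReal |v (U s ω)| with hg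
  have hgm : Measurable (Function.uncurry g) := by
    have h1 : Measurable fun p : Ω × ℝ => ENNReal.ofReal |v (U p.2 p.1)| :=
      (hv.comp (hU.comp measurable_swap)).abs.ennreal_ofReal
    exact h1.indicator (measurable_snd measurableSet_Ioi)
  have hgω : ∀ ω, Measurable (g ω) := fun ω => hgm.comp measurable_prodMk_left
  let S : Set (Fin k → ℝ) := {s | StrictMono s}
  have hGm : Measurable (Function.uncurry fun (ω : Ω) (s : Fin k → ℝ) =>
      S.indicator (fun s => ∏ i, g ω (s i)) s) := by
    have h1 : Measurable fun p : Ω × (Fin k → ℝ) => ∏ i, g p.1 (p.2 i) :=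
      Finset.measurable_prod _ fun i _ => hgm.comp
        (measurable_fst.prodMk ((measurable_pi_apply i).comp measurable_snd))
    exact h1.indicator (measurable_snd (measurableSet_strictMono k))
  calc ∫⁻ ω, (∫⁻ s in Set.Ioi (0 : ℝ), ENNReal.ofReal |v (W s ω)|) ^ k
      = ∫⁻ ω, (∫⁻ s, g ω s) ^ k := by
        refine lintegral_congr_ae ?_
        filter_upwards [hUW] with ω hω
        rw [hg, lintegral_indicator measurableSet_Ioi,
          setLIntegral_congr_fun measurableSet_Ioi fun s hs => by rw [← hω s hs]]
    _ ≤ ∫⁻ ω, (k.factorial : ℝ≥0∞) * ∫⁻ s, S.indicator (fun s => ∏ i, g ω (s i)) s :=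
        lintegral_mono fun ω => lintegral_pow_le_factorial_mul (hgω ω) k
    _ = (k.factorial : ℝ≥0∞) * ∫⁻ s, ∫⁻ ω, S.indicator (fun s => ∏ i, g ω (s i)) s := by
        rw [lintegral_const_mul _ hGm.lintegral_prod_right, lintegral_lintegral_swap hGm.aemeasurable]
    _ ≤ (k.factorial : ℝ≥0∞) * ∫⁻ s : Fin k → ℝ, ∫⁻ z : Fin k → Euc d,
          ∏ j, weightedStep d v ((prevEntry 0 s j, prevEntry x z j), (s j, z j)) := by
        gcongr with s
        by_cases hs : StrictMono s ∧ ∀ i, 0 < s i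
        · rw [← hW.lintegral_prod_eq hv hs.1 hs.2]
          refine le_of_eq (lintegral_congr_ae ?_)
          filter_upwards [hUW] with ω hω
          rw [Set.indicator_of_mem (show s ∈ S from hs.1)]
          refine Finset.prod_congr rfl fun i _ => ?_
          rw [hg, ← hω _ (hs.2 i)]
          exact Set.indicator_of_mem (s := Set.Ioi (0 : ℝ)) (hs.2 i) _
        · refine (le_of_eq ?_).trans zero_le
          refine (lintegral_congr fun ω => ?_).trans lintegral_zero
          by_cases hmono : StrictMono s
          · obtain ⟨i, hi⟩ := not_forall.1 fun h => hs ⟨hmono, h⟩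
            rw [Set.indicator_of_mem (show s ∈ S from hmono)]
            exact Finset.prod_eq_zero (Finset.mem_univ i)
              (Set.indicator_of_notMem (s := Set.Ioi (0 : ℝ)) hi _)
          · exact Set.indicator_of_notMem (show s ∉ S from hmono) _
    _ ≤ (k.factorial : ℝ≥0∞) * K ^ k := by
        gcongr
        exact lintegral_chain_le (measurable_weightedStep d hv)
          (fun p => (lintegral_weightedStep d v p).trans_le (hK p.2)) 0 x k

end IsBrownianMotion

/-- Moment bounds: `E[(∫₀^∞ |v(W_x(s))| ds)^k] ≤ k! K₁^k`. -/
theorem stmt1 (d : ℕ) (hd : 3 ≤ d) (v : Euc d → ℝ)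
    (hvm : Measurable v) (hvb : ∃ C : ℝ, ∀ z, |v z| ≤ C)
    (hvs : ∃ R : ℝ, ∀ z, v z ≠ 0 → ‖z‖ ≤ R)
    {Ω : Type*} [MeasureSpace Ω] [IsProbabilityMeasure (ℙ : Measure Ω)]
    (K₁ : ENNReal)
    (hK₁ : K₁ = ⨆ y : Euc d, ∫⁻ s in Set.Ioi (0 : ℝ), ∫⁻ z : Euc d,
      ENNReal.ofReal (|v z| * heatKernel d s (z - y))) :
    K₁ ≠ ⊤ ∧
    ∀ (k : ℕ) (x : Euc d) (W : ℝ → Ω → Euc d), IsBrownianMotion x W →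
      (∫⁻ ω, ENNReal.ofReal ((∫ s in Set.Ioi (0 : ℝ), |v (W s ω)|) ^ k)) ≤
        (Nat.factorial k : ENNReal) * K₁ ^ k := by
  refine ⟨hK₁ ▸ iSup_potential_ne_top hd hvb hvs, fun k x W hW => ?_⟩
  refine le_trans (lintegral_mono fun ω => ?_)
    (hW.lintegral_pow_le hvm (fun y => hK₁ ▸ le_iSup_of_le y le_rfl) k)
  rw [ENNReal.ofReal_pow (integral_nonneg fun _ => abs_nonneg _)]
  gcongr
  refine (Real.ofReal_le_enorm _).trans ((enorm_integral_le_lintegral_enorm _).trans_eq ?_)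
  exact lintegral_congr fun s => Real.enorm_of_nonneg (abs_nonneg _)

end
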